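/- arXiv:2009.06022 — 5 statements merged into one kernel-verified Lean document; each statement's English description precedes it below -/
import Mathlib

section
/- Discrete kinetic energy balance of the Crank–Nicolson velocity update. Let 𝒱 be a finite index set with a subset 𝒱^∂ of boundary indices, let m_i > 0, ρ_i > 0, τ > 0, let B_ij ∈ ℝ^{d×d}, F_i ∈ ℝ^d, V_i^n ∈ ℝ^d, and suppose V^{1/2} : 𝒱 → ℝ^d satisfies V_i^{1/2} = 0 for all i ∈ 𝒱^∂ and ρ_i m_i V_i^{1/2} + (τ/2) Σ_{j∈𝒱} B_ij V_j^{1/2} = m_i ρ_i V_i^n + (τ/2) m_i F_i for all i ∉ 𝒱^∂. Define V_i^{n+1} := 2 V_i^{1/2} − V_i^n. Then Σ_{i∈𝒱} ½ m_i ρ_i ‖V_i^{n+1}‖² + τ Σ_{i,j∈𝒱} V_i^{1/2} · (B_ij V_j^{1/2}) = Σ_{i∈𝒱} ½ m_i ρ_i ‖V_i^n‖² + τ Σ_{i∈𝒱} m_i F_i · V_i^{1/2}. -/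
open Matrix Finset

/-- Discrete kinetic energy balance of the Crank–Nicolson velocity update. -/
theorem kinetic_energy_balance {ι : Type*} [Fintype ι] (d : ℕ)
    (Vb : Finset ι) (m ρ : ι → ℝ) (hm : ∀ i, 0 < m i) (hρ : ∀ i, 0 < ρ i)
    (τ : ℝ) (hτ : 0 < τ)
    (B : ι → ι → Matrix (Fin d) (Fin d) ℝ)
    (F Vn Vh : ι → Fin d → ℝ)
    (hbc : ∀ i ∈ Vb, Vh i = 0)
    (heq : ∀ i ∉ Vb,
      (ρ i * m i) • Vh i + (τ / 2) • ∑ j, (B i j).mulVec (Vh j)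
        = (m i * ρ i) • Vn i + (τ / 2 * m i) • F i)
    (Vnp : ι → Fin d → ℝ) (hVnp : ∀ i, Vnp i = (2 : ℝ) • Vh i - Vn i) :
    ∑ i, (1 / 2) * m i * ρ i * (Vnp i ⬝ᵥ Vnp i)
        + τ * ∑ i, ∑ j, Vh i ⬝ᵥ (B i j).mulVec (Vh j)
      = ∑ i, (1 / 2) * m i * ρ i * (Vn i ⬝ᵥ Vn i)
        + τ * ∑ i, m i * (F i ⬝ᵥ Vh i) := by
  rw [mul_sum, mul_sum, ← sum_add_distrib, ← sum_add_distrib]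
  refine sum_congr rfl fun i _ => ?_
  rw [← dotProduct_sum, hVnp i]
  by_cases hi : i ∈ Vb
  · simp [hbc i hi]
  · have h := congrArg (Vh i ⬝ᵥ ·) (heq i hi)
    simp only [dotProduct_add, dotProduct_smul, smul_eq_mul] at h
    simp only [dotProduct_sub, sub_dotProduct, dotProduct_smul, smul_dotProduct, smul_eq_mul]
    rw [dotProduct_comm (Vn i) (Vh i), dotProduct_comm (F i) (Vh i)]
    linear_combination 2 * h
end

section
/- Minimum principle for the low-order internal-energy update. Let 𝒱 be a finite nonempty index set, m_i > 0, ρ_i > 0 for all i, τ > 0, K_i ≥ 0 for all i, e_i^n ≥ 0 for all i, and let β_ij ∈ ℝ satisfy β_ij ≤ 0 for all i ≠ j and Σ_{j∈𝒱} β_ij = 0 for every i ∈ 𝒱. If e^L : 𝒱 → ℝ satisfies m_i ρ_i (e_i^L − e_i^n) + τ Σ_{j∈𝒱} β_ij e_j^L = τ m_i K_i for every i ∈ 𝒱, then min_{j∈𝒱} e_j^L ≥ min_{j∈𝒱} (e_j^n + (τ/ρ_j) K_j) ≥ min_{j∈𝒱} e_j^n ≥ 0. -/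
open Finset

/-- At a minimizer of `u`, a row with zero sum and nonpositive off-diagonal entries
acts nonpositively on `u`. -/
theorem sum_mul_nonpos_of_isMin {ι : Type*} [Fintype ι] {b u : ι → ℝ} {i : ι}
    (hb : ∀ j, i ≠ j → b j ≤ 0) (hsum : ∑ j, b j = 0) (hi : ∀ j, u i ≤ u j) :
    ∑ j, b j * u j ≤ 0 := by
  have hshift : ∑ j, b j * u j = ∑ j, b j * (u j - u i) := by
    simp only [mul_sub, Finset.sum_sub_distrib, ← Finset.sum_mul, hsum, zero_mul, sub_zero]
  rw [hshift]
  refine Finset.sum_nonpos fun j _ => ?_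
  by_cases hij : i = j
  · simp [hij]
  · exact mul_nonpos_of_nonpos_of_nonneg (hb j hij) (sub_nonneg.2 (hi j))

/-- Minimum principle for the low-order internal-energy update. -/
theorem low_order_minimum_principle {ι : Type*} [Fintype ι] [Nonempty ι]
    (m ρ K en : ι → ℝ) (hm : ∀ i, 0 < m i) (hρ : ∀ i, 0 < ρ i)
    (τ : ℝ) (hτ : 0 < τ) (hK : ∀ i, 0 ≤ K i) (hen : ∀ i, 0 ≤ en i)
    (β : ι → ι → ℝ) (hβneg : ∀ i j, i ≠ j → β i j ≤ 0)
    (hβrow : ∀ i, ∑ j, β i j = 0)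
    (eL : ι → ℝ)
    (heq : ∀ i, m i * ρ i * (eL i - en i) + τ * ∑ j, β i j * eL j = τ * (m i * K i)) :
    Finset.univ.inf' Finset.univ_nonempty eL
        ≥ Finset.univ.inf' Finset.univ_nonempty (fun j => en j + (τ / ρ j) * K j)
    ∧ Finset.univ.inf' Finset.univ_nonempty (fun j => en j + (τ / ρ j) * K j)
        ≥ Finset.univ.inf' Finset.univ_nonempty en
    ∧ Finset.univ.inf' Finset.univ_nonempty en ≥ 0 := by
  refine ⟨?_, ?_, Finset.le_inf' _ _ fun i _ => hen i⟩
  · obtain ⟨i, -, hi⟩ := Finset.exists_mem_eq_inf' Finset.univ_nonempty eL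
    have hmin : ∀ j, eL i ≤ eL j := fun j => hi ▸ Finset.inf'_le eL (Finset.mem_univ j)
    have hdiff := sum_mul_nonpos_of_isMin (hβneg i) (hβrow i) hmin
    rw [hi]
    refine (Finset.inf'_le _ (Finset.mem_univ i)).trans ?_
    have hsource : m i * ρ i * (τ / ρ i * K i) = τ * (m i * K i) := by
      have := (hρ i).ne'
      field_simp
    refine le_of_mul_le_mul_left ?_ (mul_pos (hm i) (hρ i))
    linarith [heq i, mul_nonpos_of_nonneg_of_nonpos hτ.le hdiff]
  · refine Finset.le_inf' _ _ fun i _ => (Finset.inf'_le en (Finset.mem_univ i)).trans ?_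
    exact le_add_of_nonneg_right (mul_nonneg (div_nonneg hτ.le (hρ i).le) (hK i))
end

section
/- Minimum principle for the FCT-limited internal-energy update. Let 𝒱 be a finite index set, m_i > 0, ρ_i > 0, let A_ij ∈ ℝ for i ≠ j, let e^min ∈ ℝ, and let e^L : 𝒱 → ℝ satisfy e_i^L ≥ e^min for all i. Define P_i^− := Σ_{j≠i} min(A_ij, 0), Q_i^− := m_i ρ_i (e^min − e_i^L), λ_i^+ := 1, λ_i^− := min(1, Q_i^−/P_i^−) (with the quotient interpreted as 0 when P_i^− = 0), and ℓ_ij := min(λ_i^+, λ_j^−) if A_ij ≥ 0 and ℓ_ij := min(λ_i^−, λ_j^+) if A_ij < 0. If e^{n+1} : 𝒱 → ℝ satisfies m_i ρ_i (e_i^{n+1} − e_i^L) = Σ_{j≠i} ℓ_ij A_ij for every i, then e_i^{n+1} ≥ e^min for all i ∈ 𝒱; in particular min_{j∈𝒱} e_j^{n+1} ≥ e^min. -/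
open Finset

/-- Minimum principle for the FCT-limited internal-energy update. -/
theorem fct_minimum_principle {ι : Type*} [Fintype ι] [DecidableEq ι] [Nonempty ι]
    (m ρ : ι → ℝ) (hm : ∀ i, 0 < m i) (hρ : ∀ i, 0 < ρ i)
    (A : ι → ι → ℝ) (emin : ℝ) (eL : ι → ℝ) (heL : ∀ i, emin ≤ eL i)
    (P Q lamM : ι → ℝ) (ℓ : ι → ι → ℝ)
    (hP : ∀ i, P i = ∑ j ∈ Finset.univ.erase i, min (A i j) 0)
    (hQ : ∀ i, Q i = m i * ρ i * (emin - eL i))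
    (hlam : ∀ i, lamM i = min 1 (Q i / P i))
    (hℓ : ∀ i j, ℓ i j = if 0 ≤ A i j then min 1 (lamM j) else min (lamM i) 1)
    (en1 : ι → ℝ)
    (heq : ∀ i, m i * ρ i * (en1 i - eL i) = ∑ j ∈ Finset.univ.erase i, ℓ i j * A i j) :
    (∀ i, emin ≤ en1 i)
    ∧ emin ≤ Finset.univ.inf' Finset.univ_nonempty en1 := by
  have hPnonpos : ∀ i, P i ≤ 0 := fun i => by
    rw [hP]
    exact Finset.sum_nonpos fun j _ => min_le_right _ _
  have hQnonpos : ∀ i, Q i ≤ 0 := fun i => by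
    rw [hQ]
    exact mul_nonpos_of_nonneg_of_nonpos (mul_pos (hm i) (hρ i)).le (sub_nonpos.2 (heL i))
  have hlam_nonneg : ∀ i, 0 ≤ lamM i := fun i => by
    rw [hlam]
    exact le_min zero_le_one (div_nonneg_of_nonpos (hQnonpos i) (hPnonpos i))
  have hlam_mul : ∀ i, Q i ≤ lamM i * P i := fun i => by
    rcases (hPnonpos i).eq_or_lt with h | h
    · simpa [h] using hQnonpos i
    · exact (le_div_iff_of_neg h).1 ((hlam i).trans_le (min_le_right _ _))
  have hflux : ∀ i j, lamM i * min (A i j) 0 ≤ ℓ i j * A i j := fun i j => by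
    rw [hℓ]
    split_ifs with h
    · rw [min_eq_right h, mul_zero]
      exact mul_nonneg (le_min zero_le_one (hlam_nonneg j)) h
    · rw [min_eq_left (not_le.1 h).le,
        min_eq_left ((hlam i).trans_le (min_le_left _ _))]
  have hmin : ∀ i, emin ≤ en1 i := fun i => by
    have hle : m i * ρ i * (emin - eL i) ≤ m i * ρ i * (en1 i - eL i) := by
      rw [← hQ, heq]
      refine (hlam_mul i).trans ?_
      rw [hP, Finset.mul_sum]
      exact Finset.sum_le_sum fun j _ => hflux i j
    exact (sub_le_sub_iff_right _).1 (le_of_mul_le_mul_left hle (mul_pos (hm i) (hρ i)))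
  exact ⟨hmin, Finset.le_inf' _ _ fun i _ => hmin i⟩
end

section
/- Global internal-energy balance of the limited update. Let 𝒱 be a finite index set, m_i > 0, ρ_i > 0, τ ∈ ℝ, K_i ∈ ℝ, e_i^n ∈ ℝ, and β_ij ∈ ℝ with Σ_{i∈𝒱} β_ij = 0 for every j. Let e^L satisfy m_i ρ_i (e_i^L − e_i^n) + τ Σ_j β_ij e_j^L = τ m_i K_i for all i, let A_ij ∈ ℝ satisfy A_ij = −A_ji for i ≠ j, let ℓ_ij := min(λ_i^+, λ_j^−) if A_ij ≥ 0 and min(λ_i^−, λ_j^+) if A_ij < 0 for arbitrary reals λ_i^±, and let e^{n+1} satisfy m_i ρ_i (e_i^{n+1} − e_i^L) = Σ_{j≠i} ℓ_ij A_ij for all i. Then Σ_{i∈𝒱} m_i ρ_i e_i^{n+1} = Σ_{i∈𝒱} m_i ρ_i e_i^n + τ Σ_{i∈𝒱} m_i K_i. -/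
open Finset

/-- The off-diagonal entries of an array that is antisymmetric off the diagonal sum to zero. -/
theorem sum_sum_erase_eq_zero_of_antisymm {ι : Type*} [Fintype ι] [DecidableEq ι]
    (F : ι → ι → ℝ) (hF : ∀ i j, i ≠ j → F i j = - F j i) :
    ∑ i, ∑ j ∈ Finset.univ.erase i, F i j = 0 := by
  have hswap : ∑ i, ∑ j ∈ Finset.univ.erase i, F i j
      = ∑ i, ∑ j ∈ Finset.univ.erase i, F j i :=
    Finset.sum_comm' (by simp [ne_comm])
  have hneg : ∑ i, ∑ j ∈ Finset.univ.erase i, F i j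
      = - ∑ i, ∑ j ∈ Finset.univ.erase i, F j i := by
    simp only [← Finset.sum_neg_distrib]
    exact Finset.sum_congr rfl fun i _ => Finset.sum_congr rfl fun j hj =>
      hF i j (Finset.ne_of_mem_erase hj).symm
  linarith

/-- The limited fluxes inherit the antisymmetry of the raw fluxes. -/
theorem limited_flux_antisymm {a b p q r s : ℝ} (hab : a = -b) :
    (if 0 ≤ a then min p q else min r s) * a
      = -((if 0 ≤ b then min s r else min q p) * b) := by
  subst hab
  rcases lt_trichotomy b 0 with hb | rfl | hb
  · simp [hb.le, hb.not_ge, min_comm]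
  · simp
  · simp [hb.le, hb.not_ge, min_comm]

/-- Global internal-energy balance of the FCT-limited update. -/
theorem limited_update_energy_balance {ι : Type*} [Fintype ι] [DecidableEq ι]
    (m ρ : ι → ℝ) (hm : ∀ i, 0 < m i) (hρ : ∀ i, 0 < ρ i)
    (τ : ℝ) (K en : ι → ℝ) (β : ι → ι → ℝ)
    (hβcol : ∀ j, ∑ i, β i j = 0)
    (eL : ι → ℝ)
    (hL : ∀ i, m i * ρ i * (eL i - en i) + τ * ∑ j, β i j * eL j = τ * (m i * K i))
    (A : ι → ι → ℝ) (hA : ∀ i j, i ≠ j → A i j = - A j i)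
    (lamP lamM : ι → ℝ) (ℓ : ι → ι → ℝ)
    (hℓ : ∀ i j, ℓ i j = if 0 ≤ A i j then min (lamP i) (lamM j)
      else min (lamM i) (lamP j))
    (en1 : ι → ℝ)
    (h1 : ∀ i, m i * ρ i * (en1 i - eL i) = ∑ j ∈ Finset.univ.erase i, ℓ i j * A i j) :
    ∑ i, m i * ρ i * en1 i = ∑ i, m i * ρ i * en i + τ * ∑ i, m i * K i := by
  have hflux : ∑ i, m i * ρ i * (en1 i - eL i) = 0 := by
    simp only [h1]
    refine sum_sum_erase_eq_zero_of_antisymm (fun i j => ℓ i j * A i j) fun i j hij => ?_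
    simp only [hℓ]
    exact limited_flux_antisymm (hA i j hij)
  have htransport : ∑ i, ∑ j, β i j * eL j = 0 := by
    rw [Finset.sum_comm]
    simp [← Finset.sum_mul, hβcol]
  have hlow := Finset.sum_congr (rfl : (Finset.univ : Finset ι) = _) fun i _ => hL i
  simp only [Finset.sum_add_distrib, ← Finset.mul_sum, htransport, mul_sub,
    Finset.sum_sub_distrib] at hlow hflux
  linarith
end

section
/- Convex-combination structure and invariance of the low-order hyperbolic update. Let 𝒱 be a finite index set, fix i ∈ 𝒱, let U_j ∈ ℝ^{d+2} and f_j ∈ ℝ^{(d+2)×d} for j ∈ 𝒱, let c_j ∈ ℝ^d satisfy Σ_{j∈𝒱} c_j = 0, let d_j > 0 for all j ≠ i, let m_i > 0, and let τ ≥ 0 satisfy τ Σ_{j≠i} d_j ≤ m_i/2. Define the auxiliary bar states Ū_j := ½(U_i + U_j) − (1/(2 d_j)) (f_j − f_i) c_j for j ≠ i, and the low-order update U^L := U_i − (τ/m_i) Σ_{j∈𝒱} f_j c_j + (τ/m_i) Σ_{j≠i} d_j (U_j − U_i). Then U^L = (1 − (2τ/m_i) Σ_{j≠i} d_j) U_i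 + Σ_{j≠i} (2τ d_j/m_i) Ū_j, the coefficients of this combination are nonnegative and sum to 1, and consequently for every convex set C ⊆ ℝ^{d+2} containing U_i and Ū_j for all j ≠ i, one has U^L ∈ C. -/
open Matrix Finset

/-- A convex set contains every finite convex combination with one distinguished point. -/
lemma Convex.smul_add_sum_smul_mem {ι E : Type*} [AddCommGroup E] [Module ℝ E]
    {C : Set E} (hC : Convex ℝ C) {s : Finset ι} {a : ℝ} {w : ι → ℝ} {x : E} {z : ι → E}
    (ha : 0 ≤ a) (hw : ∀ j ∈ s, 0 ≤ w j) (hsum : a + ∑ j ∈ s, w j = 1)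
    (hx : x ∈ C) (hz : ∀ j ∈ s, z j ∈ C) :
    a • x + ∑ j ∈ s, w j • z j ∈ C := by
  have h := hC.sum_mem (t := Finset.insertNone s) (w := fun o => o.elim a w)
    (z := fun o => o.elim x z)
    (by
      rintro (_ | j) hj
      · exact ha
      · exact hw j (Finset.some_mem_insertNone.mp hj))
    (by simpa [Finset.sum_insertNone] using hsum)
    (by
      rintro (_ | j) hj
      · exact hx
      · exact hz j (Finset.some_mem_insertNone.mp hj))
  simpa [Finset.sum_insertNone] using h

/-- If the transport vectors sum to zero, the flux at `i` may be subtracted from every flux. -/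
lemma sum_mulVec_eq_sum_erase_sub_mulVec {ι κ l : Type*} [Fintype ι] [DecidableEq ι] [Fintype l]
    (i : ι) (f : ι → Matrix κ l ℝ) (c : ι → l → ℝ) (hc : ∑ j, c j = 0) :
    ∑ j, (f j).mulVec (c j) = ∑ j ∈ Finset.univ.erase i, (f j - f i).mulVec (c j) := by
  have hi : ∑ j, (f i).mulVec (c j) = 0 := by
    rw [← Matrix.mulVec_sum, hc, Matrix.mulVec_zero]
  rw [Finset.sum_erase _ (by simp)]
  simp only [Matrix.sub_mulVec, Finset.sum_sub_distrib, hi, sub_zero]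

/-- Convex-combination structure and invariance of the low-order hyperbolic
update: under the CFL condition `τ Σ_{j≠i} d_j ≤ m_i/2`, the low-order update is
a convex combination of the state `U_i` and the auxiliary bar states, and hence
belongs to every convex set containing them. -/
theorem low_order_update_convex_combination
    {ι : Type*} [Fintype ι] [DecidableEq ι] (d : ℕ) (i : ι)
    (U : ι → Fin (d + 2) → ℝ) (f : ι → Matrix (Fin (d + 2)) (Fin d) ℝ)
    (c : ι → Fin d → ℝ) (hc : ∑ j, c j = 0)
    (dc : ι → ℝ) (hdc : ∀ j, j ≠ i → 0 < dc j)
    (m : ℝ) (hm : 0 < m) (τ : ℝ) (hτ : 0 ≤ τ)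
    (hcfl : τ * ∑ j ∈ Finset.univ.erase i, dc j ≤ m / 2)
    (Ubar : ι → Fin (d + 2) → ℝ)
    (hUbar : ∀ j, j ≠ i → Ubar j
      = (1 / 2 : ℝ) • (U i + U j) - (1 / (2 * dc j)) • ((f j - f i).mulVec (c j)))
    (UL : Fin (d + 2) → ℝ)
    (hUL : UL = U i - (τ / m) • ∑ j, (f j).mulVec (c j)
      + (τ / m) • ∑ j ∈ Finset.univ.erase i, dc j • (U j - U i)) :
    (UL = (1 - (2 * τ / m) * ∑ j ∈ Finset.univ.erase i, dc j) • U i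
        + ∑ j ∈ Finset.univ.erase i, (2 * τ * dc j / m) • Ubar j)
    ∧ (0 ≤ 1 - (2 * τ / m) * ∑ j ∈ Finset.univ.erase i, dc j)
    ∧ (∀ j ∈ Finset.univ.erase i, 0 ≤ 2 * τ * dc j / m)
    ∧ ((1 - (2 * τ / m) * ∑ j ∈ Finset.univ.erase i, dc j)
        + ∑ j ∈ Finset.univ.erase i, 2 * τ * dc j / m = 1)
    ∧ (∀ C : Set (Fin (d + 2) → ℝ), Convex ℝ C → U i ∈ C →
        (∀ j ∈ Finset.univ.erase i, Ubar j ∈ C) → UL ∈ C) := by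
  have hconv : UL = (1 - (2 * τ / m) * ∑ j ∈ Finset.univ.erase i, dc j) • U i
      + ∑ j ∈ Finset.univ.erase i, (2 * τ * dc j / m) • Ubar j := by
    have hterm : ∀ j ∈ Finset.univ.erase i, (2 * τ * dc j / m) • Ubar j
        = (2 * τ / m * dc j) • U i + (τ / m) • (dc j • (U j - U i))
          - (τ / m) • (f j - f i).mulVec (c j) := by
      intro j hj
      have hd : dc j ≠ 0 := (hdc j (Finset.ne_of_mem_erase hj)).ne'
      rw [hUbar j (Finset.ne_of_mem_erase hj)]
      match_scalars <;> field_simp <;> ring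
    rw [hUL, sum_mulVec_eq_sum_erase_sub_mulVec i f c hc, Finset.sum_congr rfl hterm,
      Finset.sum_sub_distrib, Finset.sum_add_distrib, ← Finset.sum_smul, ← Finset.smul_sum,
      ← Finset.smul_sum, ← Finset.mul_sum]
    module
  have hself : 0 ≤ 1 - (2 * τ / m) * ∑ j ∈ Finset.univ.erase i, dc j := by
    have h : (2 * τ / m) * ∑ j ∈ Finset.univ.erase i, dc j
        = 2 * (τ * ∑ j ∈ Finset.univ.erase i, dc j) / m := by ring
    rw [h, sub_nonneg, div_le_one hm]
    linarith
  have hbar : ∀ j ∈ Finset.univ.erase i, 0 ≤ 2 * τ * dc j / m := fun j hj => by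
    have := hdc j (Finset.ne_of_mem_erase hj)
    positivity
  have hsum : (1 - (2 * τ / m) * ∑ j ∈ Finset.univ.erase i, dc j)
      + ∑ j ∈ Finset.univ.erase i, 2 * τ * dc j / m = 1 := by
    simp only [mul_div_right_comm, ← Finset.mul_sum, sub_add_cancel]
  refine ⟨hconv, hself, hbar, hsum, fun C hC hi hj => ?_⟩
  rw [hconv]
  exact hC.smul_add_sum_smul_mem hself hbar hsum hi hj
end
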